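/- Let g ∈ ℝ with g ≠ 0, let q = (q_w, q_x, q_y, q_z) ∈ ℝ⁴ with q_w² + q_x² + q_y² + q_z² = 1, and let ω̃ = (ω̃_x, ω̃_y, ω̃_z) ∈ ℝ³ be arbitrary. Assume q_w q_z + q_x q_y ≠ 0 and (q_x² + q_y² − q_w² − q_z²)(q_w q_x + q_y q_z)(q_x q_z − q_w q_y) ≠ 0. Then the 7×7 block matrix M₁ = [[A₁(q,g), 0_{4×3}], [C(q,ω̃,g), B(q,g)]] is invertible; equivalently, its rank is 7. -/

import Mathlib

/-- The 4×4 matrix A₁(q, g) built from rows {1,2,3,4} of the observability matrix. -/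
def A1 (qw qx qy qz g : ℝ) : Matrix (Fin 4) (Fin 4) ℝ :=
  !![-2*g*qy, 2*g*qz, -2*g*qw, 2*g*qx;
     2*g*qx, 2*g*qw, 2*g*qz, 2*g*qy;
     2*g*qw, -2*g*qx, -2*g*qy, 2*g*qz;
     2*qw - qy, 2*qx + qz, -2*qy - qw, -2*qz + qx]

/-- The 3×3 matrix B(q, g). -/
def Bmat (qw qx qy qz g : ℝ) : Matrix (Fin 3) (Fin 3) ℝ :=
  !![0, -g*(qw^2 + qz^2 - qx^2 - qy^2), -2*g*(qw*qx + qy*qz);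
     -g*(qx^2 - qw^2 - qz^2 + qy^2), 0, -2*g*(qx*qz - qw*qy);
     -2*g*(qw*qx + qy*qz), -2*g*(qw*qy - qx*qz), 0]

/-- The 3×4 matrix C(q, ω̃, g). -/
def Cmat (qw qx qy qz wx wy wz g : ℝ) : Matrix (Fin 3) (Fin 4) ℝ :=
  !![-2*g*(wy*qw - wz*qx), 2*g*(wz*qw + wy*qx), 2*g*(wy*qy + wz*qz), 2*g*(wz*qy - wy*qz);
     2*g*(wx*qw + wz*qy), -2*g*(wx*qx + wz*qz), 2*g*(wz*qw - wx*qy), 2*g*(wx*qz - wz*qx);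
     -2*g*(wx*qx + wy*qy), -2*g*(wx*qw - wy*qz), -2*g*(wy*qw + wx*qz), 2*g*(wy*qx - wx*qy)]

/-- The 7×7 observability submatrix M₁ assembled from blocks A₁, 0, C, B. -/
def M1 (qw qx qy qz wx wy wz g : ℝ) : Matrix (Fin 7) (Fin 7) ℝ :=
  (Matrix.fromBlocks (A1 qw qx qy qz g) (0 : Matrix (Fin 4) (Fin 3) ℝ)
      (Cmat qw qx qy qz wx wy wz g) (Bmat qw qx qy qz g)).submatrix
    (finSumFinEquiv (m := 4) (n := 3)).symm (finSumFinEquiv (m := 4) (n := 3)).symm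

theorem det_A1 (qw qx qy qz g : ℝ) :
    (A1 qw qx qy qz g).det =
      -32 * g ^ 3 * (qw * qz + qx * qy) * (qw ^ 2 + qx ^ 2 + qy ^ 2 + qz ^ 2) := by
  simp [A1, Matrix.det_succ_row_zero, Fin.sum_univ_succ, Fin.succAbove]
  ring

theorem det_Bmat (qw qx qy qz g : ℝ) :
    (Bmat qw qx qy qz g).det =
      8 * g ^ 3 *
        ((qx ^ 2 + qy ^ 2 - qw ^ 2 - qz ^ 2) * (qw * qx + qy * qz) * (qx * qz - qw * qy)) := by
  simp [Bmat, Matrix.det_fin_three]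
  ring

theorem det_M1 (qw qx qy qz wx wy wz g : ℝ) :
    (M1 qw qx qy qz wx wy wz g).det = (A1 qw qx qy qz g).det * (Bmat qw qx qy qz g).det := by
  rw [M1, Matrix.det_submatrix_equiv_self, Matrix.det_fromBlocks_zero₁₂]

/-- Under the stated nondegeneracy conditions, the 7×7 block matrix
`M₁ = [[A₁, 0], [C, B]]` is invertible; equivalently, its rank is 7. -/
theorem M1_invertible (g qw qx qy qz wx wy wz : ℝ) (hg : g ≠ 0)
    (hq : qw^2 + qx^2 + qy^2 + qz^2 = 1)
    (hA : qw*qz + qx*qy ≠ 0)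
    (hB : (qx^2 + qy^2 - qw^2 - qz^2) * (qw*qx + qy*qz) * (qx*qz - qw*qy) ≠ 0) :
    IsUnit (M1 qw qx qy qz wx wy wz g) ∧ (M1 qw qx qy qz wx wy wz g).rank = 7 := by
  have hdet : (M1 qw qx qy qz wx wy wz g).det ≠ 0 := by
    rw [det_M1, det_A1, det_Bmat, hq]
    have hg3 : g ^ 3 ≠ 0 := pow_ne_zero 3 hg
    exact mul_ne_zero
      (mul_ne_zero (mul_ne_zero (mul_ne_zero (by norm_num) hg3) hA) one_ne_zero)
      (mul_ne_zero (mul_ne_zero (by norm_num) hg3) hB)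
  have hunit : IsUnit (M1 qw qx qy qz wx wy wz g) :=
    (Matrix.isUnit_iff_isUnit_det _).mpr hdet.isUnit
  exact ⟨hunit, by rw [Matrix.rank_of_isUnit _ hunit, Fintype.card_fin]⟩
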